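/- arXiv:2012.03155 — 2 statements merged into one kernel-verified Lean document; each statement's English description precedes it below -/
import Mathlib

section
/- Let H be a triangle-free simple graph with minimum degree at least 4. Then for every n ≥ 5, every M(H)-saturated simple graph on n vertices has at least 2n edges. -/
/-- `H.IsMinorOf G` : `H` is a minor of `G`, via the branch-set (model) definition:
there are pairwise disjoint nonempty connected subsets of `V(G)`, one for each vertex
of `H`, with an edge of `G` between the branch sets corresponding to each edge of `H`. -/
def SimpleGraph.IsMinorOf {W V : Type*} (H : SimpleGraph W) (G : SimpleGraph V) : Prop :=
  ∃ B : W → Set V,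
    (∀ w, (B w).Nonempty) ∧
    (∀ w, (G.induce (B w)).Connected) ∧
    (Pairwise fun w₁ w₂ => Disjoint (B w₁) (B w₂)) ∧
    ∀ ⦃w₁ w₂⦄, H.Adj w₁ w₂ → ∃ v₁ ∈ B w₁, ∃ v₂ ∈ B w₂, G.Adj v₁ v₂

/-- The graph `G + uv` obtained from `G` by adding the edge `uv`. -/
def SimpleGraph.addEdge {V : Type*} (G : SimpleGraph V) (u v : V) : SimpleGraph V :=
  G ⊔ SimpleGraph.fromEdgeSet {s(u, v)}

/-- `G` is `M(H)`-saturated: `G` has no `H`-minor, but adding any edge between two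
distinct non-adjacent vertices creates an `H`-minor. -/
def MinorSaturated {W V : Type*} (H : SimpleGraph W) (G : SimpleGraph V) : Prop :=
  ¬ H.IsMinorOf G ∧
    ∀ u v : V, u ≠ v → ¬ G.Adj u v → H.IsMinorOf (G.addEdge u v)

namespace SimpleGraph

variable {W V : Type*}

theorem induce_connected_iff_forall_closed (G : SimpleGraph V) (S : Set V) :
    (G.induce S).Connected ↔ S.Nonempty ∧ ∀ P : V → Prop,
      (∀ x ∈ S, ∀ y ∈ S, G.Adj x y → P x → P y) → (∃ x ∈ S, P x) → ∀ y ∈ S, P y := by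
  constructor
  · intro h
    refine ⟨Set.nonempty_coe_sort.1 h.nonempty, ?_⟩
    rintro P hP ⟨x, hx, hPx⟩ y hy
    obtain ⟨p⟩ := h.preconnected ⟨x, hx⟩ ⟨y, hy⟩
    have key : ∀ (u v : S), (G.induce S).Walk u v → P u → P v := by
      intro u v p
      induction p with
      | nil => exact id
      | cons hadj _ ih => exact fun hu => ih (hP _ (Subtype.prop _) _ (Subtype.prop _) hadj hu)
    exact key _ _ p hPx
  · rintro ⟨hne, h⟩
    have : Nonempty S := hne.to_subtype
    refine ⟨fun x y => ?_⟩
    obtain ⟨hy, hr⟩ := h (fun z => ∃ hz : z ∈ S, (G.induce S).Reachable x ⟨z, hz⟩)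
      (fun u hu z hz hadj ⟨_, hr⟩ => ⟨hz, hr.trans
        (Adj.reachable (show (G.induce S).Adj ⟨u, hu⟩ ⟨z, hz⟩ from hadj))⟩)
      ⟨x, x.2, x.2, Reachable.refl _⟩ y y.2
    exact hr

/-- `B` is a family of branch sets witnessing that `H` is a minor of `G`. Connectedness of the
branch sets is expressed by propagation of predicates along edges. -/
structure IsMinorModel (H : SimpleGraph W) (G : SimpleGraph V) (B : W → Set V) : Prop where
  nonempty : ∀ w, (B w).Nonempty
  conn : ∀ w, ∀ P : V → Prop, (∀ x ∈ B w, ∀ y ∈ B w, G.Adj x y → P x → P y) →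
    (∃ x ∈ B w, P x) → ∀ y ∈ B w, P y
  eq_of_mem : ∀ ⦃w₁ w₂ x⦄, x ∈ B w₁ → x ∈ B w₂ → w₁ = w₂
  adj : ∀ ⦃w₁ w₂⦄, H.Adj w₁ w₂ → ∃ v₁ ∈ B w₁, ∃ v₂ ∈ B w₂, G.Adj v₁ v₂

theorem isMinorOf_iff_exists_isMinorModel (H : SimpleGraph W) (G : SimpleGraph V) :
    H.IsMinorOf G ↔ ∃ B : W → Set V, IsMinorModel H G B := by
  refine exists_congr fun B => ?_
  constructor
  · rintro ⟨h1, h2, h3, h4⟩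
    refine ⟨h1, fun w => (((induce_connected_iff_forall_closed _ _).1 (h2 w))).2, ?_, h4⟩
    intro w₁ w₂ x hx₁ hx₂
    by_contra hne
    exact Set.disjoint_left.1 (h3 hne) hx₁ hx₂
  · rintro ⟨h1, h2, h3, h4⟩
    refine ⟨h1, fun w => (induce_connected_iff_forall_closed _ _).2 ⟨h1 w, h2 w⟩, ?_, h4⟩
    intro w₁ w₂ hne
    exact Set.disjoint_left.2 fun x hx₁ hx₂ => hne (h3 hx₁ hx₂)

theorem addEdge_adj (G : SimpleGraph V) (u v x y : V) :
    (G.addEdge u v).Adj x y ↔ G.Adj x y ∨ (x ≠ y ∧ (x = u ∧ y = v ∨ x = v ∧ y = u)) := by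
  simp only [addEdge, sup_adj, fromEdgeSet_adj, Set.mem_singleton_iff, Sym2.eq_iff]
  tauto

namespace IsMinorModel

variable {H : SimpleGraph W} {G G' : SimpleGraph V} {B : W → Set V}

theorem mono_on (hB : IsMinorModel H G B)
    (h : ∀ w₁ w₂, ∀ x ∈ B w₁, ∀ y ∈ B w₂, G.Adj x y → G'.Adj x y) : IsMinorModel H G' B where
  nonempty := hB.nonempty
  conn w P hP := hB.conn w P fun x hx y hy hadj => hP x hx y hy (h _ _ x hx y hy hadj)
  eq_of_mem := hB.eq_of_mem
  adj w₁ w₂ hw := by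
    obtain ⟨x, hx, y, hy, hadj⟩ := hB.adj hw
    exact ⟨x, hx, y, hy, h _ _ x hx y hy hadj⟩

theorem card_le_of_forall_adj_mem (hB : IsMinorModel H G B) {w : W} {v : V} (hw : B w = {v})
    (N : Finset W) (hN : ∀ w' ∈ N, H.Adj w w') (T : Finset V) (hT : ∀ y, G.Adj v y → y ∈ T) :
    N.card ≤ T.card := by
  have key : ∀ w' ∈ N, ∃ y ∈ B w', y ∈ T := by
    intro w' hw'
    obtain ⟨x, hx, y, hy, hadj⟩ := hB.adj (hN w' hw')
    rw [hw, Set.mem_singleton_iff] at hx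
    subst hx
    exact ⟨y, hy, hT y hadj⟩
  have : Nonempty V := ⟨v⟩
  choose! f hf hfT using key
  refine Finset.card_le_card_of_injOn f hfT fun x hx y hy hxy => ?_
  exact hB.eq_of_mem (hf x hx) (hxy ▸ hf y hy)

theorem exists_adj_mem [Fintype W] [DecidableRel H.Adj] (hB : IsMinorModel H G B)
    (hδ : 4 ≤ H.minDegree) {w : W} {v : V} (hv : v ∈ B w) (T : Finset V) (hTc : T.card ≤ 3)
    (hT : ∀ y, G.Adj v y → y ∈ T) : ∃ z ∈ B w, G.Adj v z := by
  by_contra! hcon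
  have hw : B w = {v} := by
    refine Set.eq_singleton_iff_unique_mem.2 ⟨hv, ?_⟩
    refine hB.conn w (fun x => x = v) ?_ ⟨v, hv, rfl⟩
    rintro x hx y hy hadj rfl
    exact absurd hadj (hcon y hy)
  have h := hB.card_le_of_forall_adj_mem hw (H.neighborFinset w) (by simp) T hT
  have := H.minDegree_le_degree w
  rw [card_neighborFinset_eq_degree] at h
  omega

/-- A vertex of degree at most three whose neighbourhood is a clique can be removed from any model
of a graph of minimum degree at least four. -/
theorem exists_avoiding [Fintype W] [DecidableRel H.Adj] (hB : IsMinorModel H G B)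
    (hδ : 4 ≤ H.minDegree) (v : V) (T : Finset V) (hTc : T.card ≤ 3)
    (hT : ∀ y, G.Adj v y → y ∈ T)
    (hcl : ∀ x y, G.Adj v x → G.Adj v y → x ≠ y → G.Adj x y) :
    ∃ B' : W → Set V, IsMinorModel H G B' ∧ ∀ w, v ∉ B' w := by
  by_cases hv : ∃ w, v ∈ B w
  swap
  · exact ⟨B, hB, fun w hw => hv ⟨w, hw⟩⟩
  obtain ⟨w, hw⟩ := hv
  obtain ⟨z, hz, hvz⟩ := hB.exists_adj_mem hδ hw T hTc hT
  have hzv := hvz.ne'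
  refine ⟨fun u => B u \ {v}, ⟨fun u => ?_, fun u P hP hex => ?_, ?_, ?_⟩, fun u h => h.2 rfl⟩
  · by_cases hu : v ∈ B u
    · obtain rfl := hB.eq_of_mem hu hw
      exact ⟨z, hz, hzv⟩
    · obtain ⟨x, hx⟩ := hB.nonempty u
      exact ⟨x, hx, fun h => hu (h ▸ hx)⟩
  · obtain ⟨x, hx, hPx⟩ := hex
    have := hB.conn u
      (fun y => (y ≠ v ∧ P y) ∨ (y = v ∧ ∃ t ∈ B u, t ≠ v ∧ G.Adj v t ∧ P t)) ?_
      ⟨x, hx.1, Or.inl ⟨hx.2, hPx⟩⟩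
    · intro y hy
      rcases this y hy.1 with h | h
      · exact h.2
      · exact absurd h.1 hy.2
    · rintro p hp q hq hadj (⟨hpv, hPp⟩ | ⟨rfl, t, ht, htv, hvt, hPt⟩)
      · by_cases hqv : q = v
        · subst hqv
          exact Or.inr ⟨rfl, p, hp, hpv, hadj.symm, hPp⟩
        · exact Or.inl ⟨hqv, hP p ⟨hp, hpv⟩ q ⟨hq, hqv⟩ hadj hPp⟩
      · refine Or.inl ⟨hadj.ne', ?_⟩
        by_cases htq : t = q
        · exact htq ▸ hPt
        · exact hP t ⟨ht, htv⟩ q ⟨hq, hadj.ne'⟩ (hcl _ _ hvt hadj htq) hPt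
  · exact fun w₁ w₂ x hx₁ hx₂ => hB.eq_of_mem hx₁.1 hx₂.1
  · intro w₁ w₂ hadj
    obtain ⟨x, hx, y, hy, hxy⟩ := hB.adj hadj
    by_cases hxv : x = v
    · subst hxv
      obtain rfl := hB.eq_of_mem hx hw
      have hzy : z ≠ y := fun h => hadj.ne (hB.eq_of_mem hz (h ▸ hy))
      exact ⟨z, ⟨hz, hzv⟩, y, ⟨hy, hxy.ne'⟩, hcl _ _ hvz hxy hzy⟩
    · by_cases hyv : y = v
      · subst hyv
        obtain rfl := hB.eq_of_mem hy hw
        have hxz : x ≠ z := fun h => hadj.ne (hB.eq_of_mem hx (h ▸ hz))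
        exact ⟨x, ⟨hx, hxv⟩, z, ⟨hz, hzv⟩, hcl _ _ hxy.symm hvz hxz⟩
      · exact ⟨x, ⟨hx, hxv⟩, y, ⟨hy, hyv⟩, hxy⟩

theorem insert_vertex (hB : IsMinorModel H G B) {v a : V} (hv : ∀ w, v ∉ B w) (hva : G.Adj v a)
    {w₀ : W} (ha : a ∈ B w₀) :
    IsMinorModel H G (fun u => B u ∪ {x | x = v ∧ u = w₀}) where
  nonempty w := (hB.nonempty w).mono Set.subset_union_left
  conn w P hP hex := by
    have hex' : ∃ x ∈ B w, P x := by
      obtain ⟨x, hx | ⟨rfl, rfl⟩, hPx⟩ := hex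
      · exact ⟨x, hx, hPx⟩
      · exact ⟨a, ha, hP x (Or.inr ⟨rfl, rfl⟩) a (Or.inl ha) hva hPx⟩
    have h := hB.conn w P (fun x hx y hy => hP x (Or.inl hx) y (Or.inl hy)) hex'
    rintro y (hy | ⟨rfl, rfl⟩)
    · exact h y hy
    · exact hP a (Or.inl ha) y (Or.inr ⟨rfl, rfl⟩) hva.symm (h a ha)
  eq_of_mem := by
    rintro w₁ w₂ x (h₁ | ⟨rfl, rfl⟩) (h₂ | ⟨h, rfl⟩)
    · exact hB.eq_of_mem h₁ h₂
    · exact absurd (h ▸ h₁) (hv _)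
    · exact absurd h₂ (hv _)
    · rfl
  adj w₁ w₂ h := by
    obtain ⟨x, hx, y, hy, hxy⟩ := hB.adj h
    exact ⟨x, Or.inl hx, y, Or.inl hy, hxy⟩

/-- An added edge `ab` is superfluous if a common neighbour of `a` and `b` lies in the branch set
of `a`. -/
theorem of_addEdge_of_mem {a b v : V} (hB : IsMinorModel H (G.addEdge a b) B) (hva : G.Adj v a)
    (hvb : G.Adj v b) {w₀ : W} (hv : v ∈ B w₀) (ha : a ∈ B w₀) : IsMinorModel H G B where
  nonempty := hB.nonempty
  eq_of_mem := hB.eq_of_mem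
  conn w P hP := by
    refine hB.conn w P fun x hx y hy hadj hPx => ?_
    rcases (addEdge_adj ..).1 hadj with h | ⟨_, ⟨rfl, rfl⟩ | ⟨rfl, rfl⟩⟩
    · exact hP x hx y hy h hPx
    · obtain rfl := hB.eq_of_mem hx ha
      exact hP v hv _ hy hvb (hP _ hx v hv hva.symm hPx)
    · obtain rfl := hB.eq_of_mem hy ha
      exact hP v hv _ hy hva (hP _ hx v hv hvb.symm hPx)
  adj w₁ w₂ h := by
    obtain ⟨x, hx, y, hy, hxy⟩ := hB.adj h
    rcases (addEdge_adj ..).1 hxy with h | ⟨_, ⟨rfl, rfl⟩ | ⟨rfl, rfl⟩⟩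
    · exact ⟨x, hx, y, hy, h⟩
    · obtain rfl := hB.eq_of_mem hx ha
      exact ⟨v, hv, y, hy, hvb⟩
    · obtain rfl := hB.eq_of_mem hy ha
      exact ⟨x, hx, v, hv, hvb.symm⟩

/-- Move `v` from its branch set `B w` to the branch set `B w₀` of its neighbour `a`, where `z` is
the only neighbour of `v` in `B w`. -/
theorem move_vertex (hB : IsMinorModel H G B) {v a z : V} {w w₀ : W} (hv : v ∈ B w)
    (hz : z ∈ B w) (hvz : G.Adj v z) (huniq : ∀ y ∈ B w, G.Adj v y → y = z) (hva : G.Adj v a)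
    (ha : a ∈ B w₀) (hne : w ≠ w₀)
    (hadj : ∀ w' y, H.Adj w w' → y ∈ B w' → G.Adj v y → w' = w₀) :
    IsMinorModel H G (fun u => B u \ {v} ∪ {x | x = v ∧ u = w₀}) where
  nonempty u := by
    by_cases hu : v ∈ B u
    · obtain rfl := hB.eq_of_mem hu hv
      exact ⟨z, Or.inl ⟨hz, hvz.ne'⟩⟩
    · obtain ⟨x, hx⟩ := hB.nonempty u
      exact ⟨x, Or.inl ⟨hx, fun h => hu (h ▸ hx)⟩⟩
  eq_of_mem := by
    rintro w₁ w₂ x (h₁ | ⟨rfl, rfl⟩) (h₂ | ⟨h, rfl⟩)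
    · exact hB.eq_of_mem h₁.1 h₂.1
    · exact absurd h h₁.2
    · exact absurd rfl h₂.2
    · rfl
  conn u P hP hex := by
    by_cases hu : u = w
    · subst hu
      obtain ⟨x, hx | hx, hPx⟩ := hex
      swap
      · exact absurd hx.2 hne
      have := hB.conn u (fun y => (y ≠ v ∧ P y) ∨ (y = v ∧ P z)) ?_ ⟨x, hx.1, Or.inl ⟨hx.2, hPx⟩⟩
      · rintro y (hy | hy)
        · rcases this y hy.1 with h | h
          · exact h.2
          · exact absurd h.1 hy.2
        · exact absurd hy.2 hne
      · rintro p hp q hq hpq (⟨hpv, hPp⟩ | ⟨rfl, hPz⟩)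
        · by_cases hqv : q = v
          · subst hqv
            exact Or.inr ⟨rfl, huniq p hp hpq.symm ▸ hPp⟩
          · exact Or.inl ⟨hqv, hP p (Or.inl ⟨hp, hpv⟩) q (Or.inl ⟨hq, hqv⟩) hpq hPp⟩
        · exact Or.inl ⟨hpq.ne', (huniq q hq hpq).symm ▸ hPz⟩
    · have hvu : ∀ x ∈ B u, x ∉ ({v} : Set V) := fun x hx h => hu (hB.eq_of_mem (h ▸ hx) hv)
      have hex' : ∃ x ∈ B u, P x := by
        obtain ⟨x, hx | ⟨rfl, rfl⟩, hPx⟩ := hex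
        · exact ⟨x, hx.1, hPx⟩
        · exact ⟨a, ha, hP x (Or.inr ⟨rfl, rfl⟩) a (Or.inl ⟨ha, hvu a ha⟩) hva hPx⟩
      have h := hB.conn u P
        (fun x hx y hy => hP x (Or.inl ⟨hx, hvu x hx⟩) y (Or.inl ⟨hy, hvu y hy⟩)) hex'
      rintro y (hy | ⟨rfl, rfl⟩)
      · exact h y hy.1
      · exact hP a (Or.inl ⟨ha, hvu a ha⟩) y (Or.inr ⟨rfl, rfl⟩) hva.symm (h a ha)
  adj w₁ w₂ h := by
    obtain ⟨x, hx, y, hy, hxy⟩ := hB.adj h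
    by_cases hxv : x = v
    · subst hxv
      obtain rfl := hB.eq_of_mem hx hv
      obtain rfl := hadj w₂ y h hy hxy
      exact ⟨z, Or.inl ⟨hz, hvz.ne'⟩, x, Or.inr ⟨rfl, rfl⟩, hvz.symm⟩
    · by_cases hyv : y = v
      · subst hyv
        obtain rfl := hB.eq_of_mem hy hv
        obtain rfl := hadj w₁ x h.symm hx hxy.symm
        exact ⟨y, Or.inr ⟨rfl, rfl⟩, z, Or.inl ⟨hz, hvz.ne'⟩, hvz⟩
      · exact ⟨x, Or.inl ⟨hx, hxv⟩, y, Or.inl ⟨hy, hyv⟩, hxy⟩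

theorem of_addEdge_of_notMem {a b : V} (hB : IsMinorModel H (G.addEdge a b) B)
    (ha : ∀ w, a ∉ B w) : IsMinorModel H G B := by
  refine hB.mono_on fun w₁ w₂ x hx y hy hadj => ?_
  rcases (addEdge_adj ..).1 hadj with h | ⟨_, ⟨rfl, rfl⟩ | ⟨rfl, rfl⟩⟩
  · exact h
  · exact absurd hx (ha _)
  · exact absurd hy (ha _)

theorem of_induce {S : Set V} {B : W → Set S} (hB : IsMinorModel H (G.induce S) B) :
    IsMinorModel H G (fun w => Subtype.val '' B w) where
  nonempty w := (hB.nonempty w).image _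
  conn w P hP hex := by
    obtain ⟨_, ⟨x, hx, rfl⟩, hPx⟩ := hex
    have h := hB.conn w (fun x => P x)
      (fun x hx y hy hadj => hP x ⟨x, hx, rfl⟩ y ⟨y, hy, rfl⟩ hadj) ⟨x, hx, hPx⟩
    rintro _ ⟨y, hy, rfl⟩
    exact h y hy
  eq_of_mem := by
    rintro w₁ w₂ _ ⟨x, hx, rfl⟩ ⟨y, hy, hxy⟩
    exact hB.eq_of_mem hx (Subtype.ext hxy ▸ hy)
  adj w₁ w₂ h := by
    obtain ⟨x, hx, y, hy, hxy⟩ := hB.adj h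
    exact ⟨x, ⟨x, hx, rfl⟩, y, ⟨y, hy, rfl⟩, hxy⟩

theorem induce {S : Set V} (hB : IsMinorModel H G B) (hS : ∀ w, B w ⊆ S) :
    IsMinorModel H (G.induce S) (fun w => Subtype.val ⁻¹' B w) where
  nonempty w := by
    obtain ⟨x, hx⟩ := hB.nonempty w
    exact ⟨⟨x, hS w hx⟩, hx⟩
  conn w P hP hex := by
    obtain ⟨x, hx, hPx⟩ := hex
    have h := hB.conn w (fun y => ∃ hy : y ∈ S, P ⟨y, hy⟩)
      (fun x hx y hy hadj ⟨hxS, hPx⟩ => ⟨hS w hy, hP ⟨x, hxS⟩ hx ⟨y, hS w hy⟩ hy hadj hPx⟩)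
      ⟨x, hx, x.2, hPx⟩
    intro y hy
    obtain ⟨_, hPy⟩ := h y hy
    exact hPy
  eq_of_mem w₁ w₂ x hx hy := hB.eq_of_mem (x := x.1) hx hy
  adj w₁ w₂ h := by
    obtain ⟨x, hx, y, hy, hxy⟩ := hB.adj h
    exact ⟨⟨x, hS _ hx⟩, hx, ⟨y, hS _ hy⟩, hy, hxy⟩

end IsMinorModel

theorem addEdge_comm (G : SimpleGraph V) (a b : V) : G.addEdge a b = G.addEdge b a := by
  rw [addEdge, addEdge, Sym2.eq_swap]

end SimpleGraph

open SimpleGraph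

namespace MinorSaturated

variable {W V : Type*} {H : SimpleGraph W} {G : SimpleGraph V}

theorem not_isMinorModel (hsat : MinorSaturated H G) (B : W → Set V) : ¬ IsMinorModel H G B :=
  fun h => hsat.1 ((isMinorOf_iff_exists_isMinorModel H G).2 ⟨B, h⟩)

theorem exists_isMinorModel (hsat : MinorSaturated H G) {a b : V} (hab : a ≠ b)
    (h : ¬ G.Adj a b) : ∃ B : W → Set V, IsMinorModel H (G.addEdge a b) B :=
  (isMinorOf_iff_exists_isMinorModel H _).1 (hsat.2 a b hab h)

/-- In a saturated graph, the neighbourhood of a vertex of degree at most three is a clique. -/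
theorem adj_of_adj_of_adj [Fintype W] [DecidableRel H.Adj] (hδ : 4 ≤ H.minDegree)
    (htf : H.CliqueFree 3) (hsat : MinorSaturated H G) {v a b : V} (T : Finset V) (hTc : T.card ≤ 3)
    (hT : ∀ y, G.Adj v y → y ∈ T) (hva : G.Adj v a) (hvb : G.Adj v b) (hab : a ≠ b) :
    G.Adj a b := by
  classical
  by_contra hnab
  obtain ⟨B, hB⟩ := hsat.exists_isMinorModel hab hnab
  have hle : ∀ x y, G.Adj x y → (G.addEdge a b).Adj x y :=
    fun x y h => (addEdge_adj ..).2 (Or.inl h)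
  have hvG : ∀ y, (G.addEdge a b).Adj v y → G.Adj v y := by
    intro y h
    rcases (addEdge_adj ..).1 h with h | ⟨_, ⟨h, _⟩ | ⟨h, _⟩⟩
    · exact h
    · exact absurd h hva.ne
    · exact absurd h hvb.ne
  have hBb : IsMinorModel H (G.addEdge b a) B := G.addEdge_comm a b ▸ hB
  obtain ⟨wa, hwa⟩ : ∃ wa, a ∈ B wa := by
    by_contra! h
    exact hsat.not_isMinorModel B (hB.of_addEdge_of_notMem h)
  obtain ⟨wb, hwb⟩ : ∃ wb, b ∈ B wb := by
    by_contra! h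
    exact hsat.not_isMinorModel B (hBb.of_addEdge_of_notMem h)
  by_cases hv : ∃ w, v ∈ B w
  swap
  · have h := hB.insert_vertex (fun w hw => hv ⟨w, hw⟩) (hle _ _ hva) hwa
    exact hsat.not_isMinorModel _
      (h.of_addEdge_of_mem hva hvb (Or.inr ⟨rfl, rfl⟩) (Or.inl hwa))
  obtain ⟨w, hw⟩ := hv
  have hwwa : w ≠ wa := by
    rintro rfl
    exact hsat.not_isMinorModel B (hB.of_addEdge_of_mem hva hvb hw hwa)
  have hwwb : w ≠ wb := by
    rintro rfl
    exact hsat.not_isMinorModel B (hBb.of_addEdge_of_mem hvb hva hw hwb)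
  obtain ⟨z, hz, hvz⟩ := hB.exists_adj_mem hδ hw T hTc fun y hy => hT y (hvG y hy)
  have hza : z ≠ a := fun h => hwwa (hB.eq_of_mem hz (h ▸ hwa))
  have hzb : z ≠ b := fun h => hwwb (hB.eq_of_mem hz (h ▸ hwb))
  have hN : ∀ y, (G.addEdge a b).Adj v y → y = a ∨ y = b ∨ y = z := by
    intro y hy
    by_contra! hne
    have hsub : ({y, a, b, z} : Finset V) ⊆ T := by
      intro t ht
      simp only [Finset.mem_insert, Finset.mem_singleton] at ht
      rcases ht with rfl | rfl | rfl | rfl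
      exacts [hT _ (hvG _ hy), hT _ hva, hT _ hvb, hT _ (hvG _ hvz)]
    have hcard : ({y, a, b, z} : Finset V).card = 4 := by
      rw [Finset.card_insert_of_notMem (by simp [hne]), Finset.card_eq_three.2
        ⟨a, b, z, hab, hza.symm, hzb.symm, rfl⟩]
    have := Finset.card_le_card hsub
    omega
  have huniq : ∀ y ∈ B w, (G.addEdge a b).Adj v y → y = z := by
    intro y hy hvy
    rcases hN y hvy with rfl | rfl | rfl
    · exact absurd (hB.eq_of_mem hy hwa) hwwa
    · exact absurd (hB.eq_of_mem hy hwb) hwwb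
    · rfl
  by_cases h1 : H.Adj w wb → wb = wa
  · have h := hB.move_vertex hw hz hvz huniq (hle _ _ hva) hwa hwwa (by
      intro w' y hww' hy hvy
      rcases hN y hvy with rfl | rfl | rfl
      · exact hB.eq_of_mem hy hwa
      · obtain rfl := hB.eq_of_mem hy hwb
        exact h1 hww'
      · exact absurd (hB.eq_of_mem hz hy) hww'.ne)
    exact hsat.not_isMinorModel _ (h.of_addEdge_of_mem hva hvb (Or.inr ⟨rfl, rfl⟩)
      (Or.inl ⟨hwa, hva.ne'⟩))
  by_cases h2 : H.Adj w wa → wa = wb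
  · have h := hB.move_vertex hw hz hvz huniq (hle _ _ hvb) hwb hwwb (by
      intro w' y hww' hy hvy
      rcases hN y hvy with rfl | rfl | rfl
      · obtain rfl := hB.eq_of_mem hy hwa
        exact h2 hww'
      · exact hB.eq_of_mem hy hwb
      · exact absurd (hB.eq_of_mem hz hy) hww'.ne)
    rw [addEdge_comm] at h
    exact hsat.not_isMinorModel _ (h.of_addEdge_of_mem hvb hva (Or.inr ⟨rfl, rfl⟩)
      (Or.inl ⟨hwb, hvb.ne'⟩))
  push Not at h1 h2
  have hwab : ¬ H.Adj wa wb := fun h =>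
    htf {w, wa, wb} (is3Clique_triple_iff.2 ⟨h2.1, h1.1, h⟩)
  refine hsat.not_isMinorModel B ⟨hB.nonempty, fun u P hP => hB.conn u P ?_, hB.eq_of_mem, ?_⟩
  · intro x hx y hy hadj
    rcases (addEdge_adj ..).1 hadj with h | ⟨_, ⟨rfl, rfl⟩ | ⟨rfl, rfl⟩⟩
    · exact hP x hx y hy h
    · exact absurd ((hB.eq_of_mem hwa hx).trans (hB.eq_of_mem hy hwb)) h2.2
    · exact absurd ((hB.eq_of_mem hwb hx).trans (hB.eq_of_mem hy hwa)) h1.2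
  · intro w₁ w₂ h
    obtain ⟨x, hx, y, hy, hadj⟩ := hB.adj h
    rcases (addEdge_adj ..).1 hadj with h' | ⟨_, ⟨rfl, rfl⟩ | ⟨rfl, rfl⟩⟩
    · exact ⟨x, hx, y, hy, h'⟩
    · obtain rfl := hB.eq_of_mem hx hwa
      obtain rfl := hB.eq_of_mem hy hwb
      exact absurd h hwab
    · obtain rfl := hB.eq_of_mem hx hwb
      obtain rfl := hB.eq_of_mem hy hwa
      exact absurd h.symm hwab

/-- A new edge `vx` of a saturated graph cannot give `v` a clique neighbourhood of size at most
three. -/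
theorem false_of_addEdge_clique [Fintype W] [DecidableRel H.Adj] (hδ : 4 ≤ H.minDegree)
    (hsat : MinorSaturated H G) {v x : V}
    (hvx : v ≠ x) (hnadj : ¬ G.Adj v x) (T : Finset V) (hTc : T.card ≤ 3) (hx : x ∈ T)
    (hT : ∀ y, G.Adj v y → y ∈ T) (hcl : ∀ p ∈ T, ∀ q ∈ T, p ≠ q → G.Adj p q) : False := by
  obtain ⟨B, hB⟩ := hsat.exists_isMinorModel hvx hnadj
  have hT' : ∀ y, (G.addEdge v x).Adj v y → y ∈ T := by
    intro y hy
    rcases (addEdge_adj ..).1 hy with h | ⟨_, ⟨_, rfl⟩ | ⟨h, _⟩⟩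
    · exact hT y h
    · exact hx
    · exact absurd h hvx
  obtain ⟨B', hB', hav⟩ := hB.exists_avoiding hδ v T hTc hT' fun p q hp hq hpq =>
    (addEdge_adj ..).2 (Or.inl (hcl p (hT' p hp) q (hT' q hq) hpq))
  exact hsat.not_isMinorModel B' (hB'.of_addEdge_of_notMem hav)

theorem exists_two_adj [Fintype W] [DecidableRel H.Adj] (hδ : 4 ≤ H.minDegree)
    (hsat : MinorSaturated H G) [Fintype V]
    (hV : 3 ≤ Fintype.card V) (v : V) : ∃ a b, a ≠ b ∧ G.Adj v a ∧ G.Adj v b := by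
  classical
  by_contra! hcon
  obtain ⟨a, hva⟩ : ∃ a, G.Adj v a := by
    by_contra! h0
    obtain ⟨x, hx⟩ := Fintype.exists_ne_of_one_lt_card (by omega) v
    exact hsat.false_of_addEdge_clique hδ hx.symm (h0 x) {x} (by simp) (by simp)
      (fun y hy => absurd hy (h0 y)) (by simp)
  have hav : ∀ y, G.Adj v y → y = a := fun y hy => by
    by_contra hne
    exact hcon y a hne hy hva
  have ha : ∀ x, G.Adj a x → x = v := by
    intro x hax
    by_contra hxv
    refine hsat.false_of_addEdge_clique hδ (Ne.symm hxv)
      (fun h => hax.ne (hav x h).symm) {a, x}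
      (Finset.card_le_two.trans (by norm_num)) (by simp) (fun y hy => by simp [hav y hy]) ?_
    intro p hp q hq hpq
    simp only [Finset.mem_insert, Finset.mem_singleton] at hp hq
    rcases hp with rfl | rfl <;> rcases hq with rfl | rfl
    exacts [absurd rfl hpq, hax, hax.symm, absurd rfl hpq]
  obtain ⟨x, hx⟩ : ∃ x, x ∉ ({v, a} : Finset V) := by
    by_contra! h
    have h1 := Finset.card_le_card (show Finset.univ ⊆ ({v, a} : Finset V) from fun x _ => h x)
    have h2 : ({v, a} : Finset V).card ≤ 2 := Finset.card_le_two
    rw [Finset.card_univ] at h1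
    omega
  simp only [Finset.mem_insert, Finset.mem_singleton, not_or] at hx
  obtain ⟨B, hB⟩ := hsat.exists_isMinorModel (Ne.symm hx.1) fun h => hx.2 (hav x h)
  have haG : ∀ y, (G.addEdge v x).Adj a y → y = v := by
    intro y hy
    rcases (addEdge_adj ..).1 hy with h | ⟨_, ⟨h, _⟩ | ⟨h, _⟩⟩
    · exact ha y h
    · exact absurd h hva.ne'
    · exact absurd h.symm hx.2
  obtain ⟨B', hB', hBa⟩ := hB.exists_avoiding hδ a {v} (by simp) (by simpa using haG)
    fun p q hp hq hpq => absurd ((haG p hp).trans (haG q hq).symm) hpq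
  have hB2 : IsMinorModel H ((G.addEdge v x).deleteIncidenceSet a) B' :=
    hB'.mono_on fun w₁ w₂ p hp q hq hadj => (deleteIncidenceSet_adj).2
      ⟨hadj, fun h => hBa _ (h ▸ hp), fun h => hBa _ (h ▸ hq)⟩
  have hvG : ∀ y, ((G.addEdge v x).deleteIncidenceSet a).Adj v y → y = x := by
    intro y hy
    obtain ⟨h, _, hya⟩ := (deleteIncidenceSet_adj).1 hy
    rcases (addEdge_adj ..).1 h with h | ⟨_, ⟨_, h⟩ | ⟨h, _⟩⟩
    · exact absurd (hav y h) hya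
    · exact h
    · exact absurd h.symm hx.1
  obtain ⟨B₂, hB₂, hBv⟩ := hB2.exists_avoiding hδ v {x} (by simp) (by simpa using hvG)
    fun p q hp hq hpq => absurd ((hvG p hp).trans (hvG q hq).symm) hpq
  have hB₃ : IsMinorModel H (G.addEdge v x) B₂ :=
    hB₂.mono_on fun _ _ _ _ _ _ hadj => ((deleteIncidenceSet_adj).1 hadj).1
  exact hsat.not_isMinorModel B₂ (hB₃.of_addEdge_of_notMem hBv)

/-- Deleting a vertex of degree at most three with a clique neighbourhood preserves saturation. -/
theorem induce_compl_singleton [Fintype W] [DecidableRel H.Adj] (hδ : 4 ≤ H.minDegree)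
    (hsat : MinorSaturated H G) (v : V)
    (T : Finset V) (hTc : T.card ≤ 3) (hT : ∀ y, G.Adj v y → y ∈ T)
    (hcl : ∀ x y, G.Adj v x → G.Adj v y → x ≠ y → G.Adj x y) :
    MinorSaturated H (G.induce ({v}ᶜ : Set V)) := by
  constructor
  · rw [isMinorOf_iff_exists_isMinorModel]
    rintro ⟨B, hB⟩
    exact hsat.not_isMinorModel _ hB.of_induce
  · intro a b hab hnadj
    obtain ⟨B, hB⟩ := hsat.exists_isMinorModel (a := a.1) (b := b.1)
      (fun h => hab (Subtype.ext h)) hnadj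
    have hvG : ∀ y, (G.addEdge a.1 b.1).Adj v y → G.Adj v y := by
      intro y hy
      rcases (addEdge_adj ..).1 hy with h | ⟨_, ⟨h, _⟩ | ⟨h, _⟩⟩
      · exact h
      · exact absurd h.symm a.2
      · exact absurd h.symm b.2
    obtain ⟨B', hB', hav⟩ := hB.exists_avoiding hδ v T hTc (fun y hy => hT y (hvG y hy))
      fun p q hp hq hpq => (addEdge_adj ..).2 (Or.inl (hcl p q (hvG p hp) (hvG q hq) hpq))
    rw [isMinorOf_iff_exists_isMinorModel]
    refine ⟨_, (hB'.induce (S := {v}ᶜ) fun w x hx h => hav w (h ▸ hx)).mono_on ?_⟩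
    intro _ _ x _ y _ hadj
    rw [addEdge_adj]
    rcases (addEdge_adj ..).1 hadj with h | ⟨hne, h⟩
    · exact Or.inl h
    · refine Or.inr ⟨fun h => hne (congrArg _ h), ?_⟩
      simp only [Subtype.ext_iff]
      exact h

theorem eq_top_of_card_lt [Fintype W] [Fintype V] (hsat : MinorSaturated H G)
    (h : Fintype.card V < Fintype.card W) : G = ⊤ := by
  ext a b
  refine ⟨fun h => h.ne, fun hab => ?_⟩
  by_contra hnadj
  obtain ⟨B, hB⟩ := hsat.exists_isMinorModel hab hnadj
  choose f hf using hB.nonempty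
  exact absurd (Fintype.card_le_of_injective f fun x y hxy =>
    hB.eq_of_mem (hf x) (hxy ▸ hf y)) (by omega)

end MinorSaturated

namespace SimpleGraph

variable {W : Type*} [Fintype W] {H : SimpleGraph W} [DecidableRel H.Adj]

/-- In a triangle-free graph, the neighbourhoods of adjacent vertices are disjoint. -/
theorem CliqueFree.two_mul_minDegree_le_card (htf : H.CliqueFree 3) (h : 0 < H.minDegree) :
    2 * H.minDegree ≤ Fintype.card W := by
  classical
  have : Nonempty W := by
    by_contra hne
    rw [not_nonempty_iff] at hne
    simp at h
  obtain ⟨w⟩ := this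
  obtain ⟨w', hw'⟩ := (H.degree_pos_iff_exists_adj w).1 (h.trans_le (H.minDegree_le_degree w))
  have hdis : Disjoint (H.neighborFinset w) (H.neighborFinset w') := by
    rw [Finset.disjoint_left]
    intro x hx hx'
    rw [mem_neighborFinset] at hx hx'
    exact htf {w, w', x} (is3Clique_triple_iff.2 ⟨hw', hx, hx'⟩)
  have hc := Finset.card_le_univ (H.neighborFinset w ∪ H.neighborFinset w')
  rw [Finset.card_union_of_disjoint hdis, card_neighborFinset_eq_degree,
    card_neighborFinset_eq_degree] at hc
  have := H.minDegree_le_degree w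
  have := H.minDegree_le_degree w'
  omega

end SimpleGraph

/-- If `H` is triangle-free with `δ(H) ≥ 4`, then for every `n ≥ 5`,
every `M(H)`-saturated graph on `n` vertices has at least `2n` edges. -/
theorem sat_minor_lower_bound_minDegree_four_triangleFree
    {W : Type*} [Fintype W] (H : SimpleGraph W) [DecidableRel H.Adj]
    (hδ : 4 ≤ H.minDegree) (htf : H.CliqueFree 3)
    {V : Type*} [Fintype V] (G : SimpleGraph V) (n : ℕ) (hn : 5 ≤ n)
    (hV : Fintype.card V = n) (hsat : MinorSaturated H G) :
    2 * n ≤ G.edgeSet.ncard := by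
  classical
  induction n, hn using Nat.le_induction generalizing V with
  | base =>
    have hW := htf.two_mul_minDegree_le_card (by omega)
    obtain rfl := hsat.eq_top_of_card_lt (by omega)
    rw [← coe_edgeFinset, Set.ncard_coe_finset, card_edgeFinset_top_eq_card_choose_two, hV]
    decide
  | succ n hn ih =>
    rw [← coe_edgeFinset, Set.ncard_coe_finset]
    by_cases hdeg : ∀ v, 4 ≤ G.degree v
    · have h1 := G.sum_degrees_eq_twice_card_edges
      have h2 := Finset.card_nsmul_le_sum Finset.univ (fun v => G.degree v) 4 fun v _ => hdeg v
      rw [Finset.card_univ, hV, smul_eq_mul] at h2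
      omega
    · push Not at hdeg
      obtain ⟨v, hv⟩ := hdeg
      have hTc : (G.neighborFinset v).card ≤ 3 := by
        rw [card_neighborFinset_eq_degree]
        omega
      have hT : ∀ y, G.Adj v y → y ∈ G.neighborFinset v := by simp
      have hsat' := hsat.induce_compl_singleton hδ v _ hTc hT fun x y hx hy hxy =>
        hsat.adj_of_adj_of_adj hδ htf _ hTc hT hx hy hxy
      have hIH := ih (G.induce ({v}ᶜ : Set V)) (by
        rw [Fintype.card_compl_set, hV]; simp) hsat'
      rw [← coe_edgeFinset, Set.ncard_coe_finset] at hIH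
      have hcard := G.card_edgeFinset_induce_compl_singleton v
      obtain ⟨a, b, hab, hva, hvb⟩ := hsat.exists_two_adj hδ (by omega) v
      have h2 : 2 ≤ G.degree v := by
        rw [← card_neighborFinset_eq_degree, ← Finset.card_pair hab]
        refine Finset.card_le_card fun x hx => ?_
        simp only [Finset.mem_insert, Finset.mem_singleton] at hx
        rcases hx with rfl | rfl <;> simpa
      have hle := G.degree_le_card_edgeFinset v
      rw [G.card_edgeFinset_deleteIncidenceSet v] at hcard
      omega
end

section
/- Let H be a connected simple graph with s := |V(H)| vertices and minimum degree exactly d := δ(H) ≥ 3. Fix one (d-1)-element subset S₀ of the vertex set of the complete graph K^{s-1}, and let G be the graph obtained from K^{s-1} by adding, for each (d-1)-element subset S ≠ S₀ of its vertices, a new vertex adjacent to every vertex of S. Then G is M(H)-saturated, and G has (s-1) + C(s-1,d-1) - 1 vertices and C(s-1,2) + (d-1)·C(s-1,d-1) - (d-1) edges, where C(a,b) denotes the binomial coefficient. -/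
/-- The construction graph: a complete graph on `Fin m`, together with, for each
`d`-element subset `S ≠ S₀` of `Fin m`, an extra vertex joined to every vertex of `S`.
(In the application, `m = s - 1` and `d = δ(H) - 1`.) -/
def constructionGraph (m d : ℕ) (S₀ : Finset (Fin m)) :
    SimpleGraph (Fin m ⊕ {S : Finset (Fin m) // S.card = d ∧ S ≠ S₀}) :=
  SimpleGraph.fromRel fun a b =>
    match a, b with
    | Sum.inl _, Sum.inl _ => True
    | Sum.inl a, Sum.inr S => a ∈ S.1
    | _, _ => False

theorem SimpleGraph.connected_induce_singleton {V : Type*} (G : SimpleGraph V) (v : V) :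
    (G.induce {v}).Connected :=
  (SimpleGraph.connected_iff _).2 ⟨SimpleGraph.Preconnected.of_subsingleton, inferInstance⟩

section Construction

variable {m k : ℕ} {S₀ : Finset (Fin m)}

@[simp]
theorem constructionGraph_adj_inl_inl (a b : Fin m) :
    (constructionGraph m k S₀).Adj (Sum.inl a) (Sum.inl b) ↔ a ≠ b := by
  simp [constructionGraph]

@[simp]
theorem constructionGraph_adj_inl_inr (a : Fin m)
    (S : {S : Finset (Fin m) // S.card = k ∧ S ≠ S₀}) :
    (constructionGraph m k S₀).Adj (Sum.inl a) (Sum.inr S) ↔ a ∈ S.1 := by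
  simp [constructionGraph]

@[simp]
theorem constructionGraph_adj_inr_inl (a : Fin m)
    (S : {S : Finset (Fin m) // S.card = k ∧ S ≠ S₀}) :
    (constructionGraph m k S₀).Adj (Sum.inr S) (Sum.inl a) ↔ a ∈ S.1 := by
  simp [constructionGraph]

@[simp]
theorem constructionGraph_not_adj_inr_inr
    (S T : {S : Finset (Fin m) // S.card = k ∧ S ≠ S₀}) :
    ¬ (constructionGraph m k S₀).Adj (Sum.inr S) (Sum.inr T) := by
  simp [constructionGraph]

/-- A graph with more than `m` vertices, all of degree more than `k`, is not a minor of the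
construction graph. -/
theorem not_isMinorOf_constructionGraph {W : Type*} [Fintype W] (H : SimpleGraph W)
    [DecidableRel H.Adj] (hW : m < Fintype.card W) (hdeg : ∀ w, k < H.degree w) :
    ¬ H.IsMinorOf (constructionGraph m k S₀) := by
  rintro ⟨B, hne, hconn, hdisj, hadj⟩
  have eq_of_mem {x y : W} {v} (hx : v ∈ B x) (hy : v ∈ B y) : x = y := by
    by_contra hxy
    exact Set.disjoint_left.1 (hdisj hxy) hx hy
  obtain ⟨w, hw⟩ : ∃ w, ∀ a : Fin m, Sum.inl a ∉ B w := by
    by_contra! h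
    choose f hf using h
    have hf_inj : Function.Injective f := fun x y hxy => eq_of_mem (hf x) (hxy ▸ hf y)
    have := Fintype.card_le_of_injective f hf_inj
    rw [Fintype.card_fin] at this
    omega
  have hbot : (constructionGraph m k S₀).induce (B w) = ⊥ := by
    ext ⟨a | S, ha⟩ ⟨b | T, hb⟩
    · exact absurd ha (hw a)
    · exact absurd ha (hw a)
    · exact absurd hb (hw b)
    · simp
  have hsub : Subsingleton (B w) := by
    have := (hconn w).preconnected
    rwa [hbot, SimpleGraph.preconnected_bot_iff_subsingleton] at this
  obtain ⟨a | S, hS⟩ := hne w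
  · exact hw a hS
  have hnbr : ∀ x, H.Adj w x → ∃ a ∈ S.1, Sum.inl a ∈ B x := by
    intro x hx
    obtain ⟨v, hv, y, hy, hvy⟩ := hadj hx
    obtain rfl : v = Sum.inr S := congrArg Subtype.val (hsub.elim ⟨v, hv⟩ ⟨_, hS⟩)
    obtain a | T := y
    · exact ⟨a, by simpa using hvy, hy⟩
    · simp at hvy
  choose f hfS hfB using hnbr
  have hadj_of_mem (x : H.neighborFinset w) : H.Adj w x :=
    (H.mem_neighborFinset w x).1 x.2
  have hle := Fintype.card_le_of_injective
    (fun x : H.neighborFinset w => (⟨f x (hadj_of_mem x), hfS x (hadj_of_mem x)⟩ : S.1))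
    fun x y hxy => by
      have hf : f x (hadj_of_mem x) = f y (hadj_of_mem y) := Subtype.ext_iff.1 hxy
      exact Subtype.ext (eq_of_mem (hfB x (hadj_of_mem x)) (hf ▸ hfB y (hadj_of_mem y)))
  rw [Fintype.card_coe, Fintype.card_coe, H.card_neighborFinset_eq_degree, S.2.1] at hle
  exact absurd (hdeg w) (by omega)

/-- Suppose `Fin m` spans a clique of `G` and `B₀` is a connected set disjoint from this clique with
neighbours in at least `H.degree w` of its vertices. If `H` has `m + 1` vertices, then `H` is a
minor of `G`, with `B₀` as the branch set of `w`. -/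
theorem SimpleGraph.isMinorOf_of_clique_of_connected {W E : Type*} [Fintype W] {H : SimpleGraph W}
    [DecidableRel H.Adj] {G : SimpleGraph (Fin m ⊕ E)}
    (hG : ∀ a b : Fin m, a ≠ b → G.Adj (Sum.inl a) (Sum.inl b))
    (hW : Fintype.card W = m + 1) (w : W) (B₀ : Set (Fin m ⊕ E))
    (hB₀ : ∀ a, Sum.inl a ∉ B₀) (hconn : (G.induce B₀).Connected)
    (T : Finset (Fin m)) (hT : H.degree w ≤ T.card)
    (hadj : ∀ a ∈ T, ∃ v ∈ B₀, G.Adj v (Sum.inl a)) :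
    H.IsMinorOf G := by
  classical
  obtain ⟨φ, hφw, hφ⟩ : ∃ φ : W ≃ Option (Fin m), φ w = none ∧
      ∀ x, H.Adj w x → ∃ a ∈ T, φ x = some a := by
    obtain ⟨T', hT', hcard⟩ := Finset.exists_subset_card_eq hT
    let e : H.neighborFinset w ≃ T' := Finset.equivOfCardEq (by simp [hcard])
    let f : W → Option (Fin m) := fun x =>
      if hx : x ∈ H.neighborFinset w then some (e ⟨x, hx⟩).1 else none
    have hf {x} (hx : x ∈ H.neighborFinset w) : f x = some (e ⟨x, hx⟩).1 := dif_pos hx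
    have hfw : f w = none := dif_neg (by simp)
    have hinj : Set.InjOn f ↑(insert w (H.neighborFinset w)) := by
      intro x hx y hy hxy
      rw [Finset.mem_coe, Finset.mem_insert] at hx hy
      rcases hx with rfl | hx <;> rcases hy with rfl | hy
      · rfl
      · simp [hfw, hf hy] at hxy
      · simp [hfw, hf hx] at hxy
      · rw [hf hx, hf hy, Option.some_inj, Subtype.val_inj, e.apply_eq_iff_eq] at hxy
        exact congrArg Subtype.val hxy
    obtain ⟨g, hg⟩ := Finset.exists_equiv_extend_of_card_eq (t := Finset.univ)
      (by simp [hW]) (Finset.subset_univ _) hinj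
    refine ⟨g.trans (Equiv.subtypeUnivEquiv Finset.mem_univ), ?_, fun x hx => ?_⟩
    · simpa [hfw] using hg w (by simp)
    · have hx' : x ∈ H.neighborFinset w := by simpa using hx
      exact ⟨_, hT' (e ⟨x, hx'⟩).2, by simpa [hf hx'] using hg x (by simp [hx])⟩
  have hφ_some {x y} {a} (hx : φ x = some a) (hy : φ y = some a) : x = y :=
    φ.injective (hx.trans hy.symm)
  have hφ_none {x} (hx : φ x = none) : x = w := φ.injective (hx.trans hφw.symm)
  let b : Option (Fin m) → Set (Fin m ⊕ E) := fun o => o.elim B₀ fun a => {Sum.inl a}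
  refine ⟨fun x => b (φ x), fun x => ?_, fun x => ?_, fun x y hxy => ?_, fun x y hxy => ?_⟩
  · dsimp only
    cases φ x with
    | none => exact Set.nonempty_coe_sort.1 hconn.nonempty
    | some a => exact Set.singleton_nonempty _
  · dsimp only
    cases φ x with
    | none => exact hconn
    | some a => exact G.connected_induce_singleton _
  · have hne : φ x ≠ φ y := φ.injective.ne hxy
    dsimp only
    generalize φ x = p at hne
    generalize φ y = q at hne
    cases p <;> cases q
    · exact absurd rfl hne
    · exact Set.disjoint_singleton_right.2 (hB₀ _)
    · exact Set.disjoint_singleton_left.2 (hB₀ _)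
    · simpa [b, eq_comm] using hne
  · dsimp only
    rcases hx : φ x with _ | a <;> rcases hy : φ y with _ | c
    · exact absurd ((hφ_none hx).trans (hφ_none hy).symm) hxy.ne
    · obtain rfl := hφ_none hx
      obtain ⟨a, ha, hya⟩ := hφ y hxy
      obtain rfl : c = a := Option.some_inj.1 (hy.symm.trans hya)
      obtain ⟨v, hv, hvc⟩ := hadj c ha
      exact ⟨v, hv, _, rfl, hvc⟩
    · obtain rfl := hφ_none hy
      obtain ⟨c, hc, hxc⟩ := hφ x hxy.symm
      obtain rfl : a = c := Option.some_inj.1 (hx.symm.trans hxc)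
      obtain ⟨v, hv, hva⟩ := hadj a hc
      exact ⟨_, rfl, v, hv, hva.symm⟩
    · refine ⟨_, rfl, _, rfl, hG a c ?_⟩
      rintro rfl
      exact hxy.ne (hφ_some hx hy)

/-- If `H` has `m + 1` vertices and a vertex of degree at most `k + 1`, then adding any edge to the
construction graph creates an `H`-minor. -/
theorem isMinorOf_constructionGraph_addEdge {W : Type*} [Fintype W] (H : SimpleGraph W)
    [DecidableRel H.Adj] (hW : Fintype.card W = m + 1) (w : W) (hw : H.degree w ≤ k + 1)
    {u v : Fin m ⊕ {S : Finset (Fin m) // S.card = k ∧ S ≠ S₀}} (huv : u ≠ v)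
    (hadj : ¬ (constructionGraph m k S₀).Adj u v) :
    H.IsMinorOf ((constructionGraph m k S₀).addEdge u v) := by
  have hle : constructionGraph m k S₀ ≤ (constructionGraph m k S₀).addEdge u v := le_sup_left
  have huv_adj : ((constructionGraph m k S₀).addEdge u v).Adj u v := by
    simp [SimpleGraph.addEdge, huv]
  generalize (constructionGraph m k S₀).addEdge u v = G at hle huv_adj
  have hclique : ∀ a b : Fin m, a ≠ b → G.Adj (Sum.inl a) (Sum.inl b) :=
    fun a b hab => hle (by simpa using hab)
  have key (a : Fin m) (S : {S : Finset (Fin m) // S.card = k ∧ S ≠ S₀}) (ha : a ∉ S.1)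
      (haS : G.Adj (Sum.inl a) (Sum.inr S)) : H.IsMinorOf G := by
    refine SimpleGraph.isMinorOf_of_clique_of_connected hclique hW w {Sum.inr S} (by simp) ?_
      (insert a S.1) (by rwa [Finset.card_insert_of_notMem ha, S.2.1]) fun c hc => ?_
    · exact G.connected_induce_singleton _
    · refine ⟨_, rfl, ?_⟩
      rcases Finset.mem_insert.1 hc with rfl | hc
      · exact haS.symm
      · exact hle (by simpa using hc)
  rcases u with a | S <;> rcases v with b | T
  · exact absurd (by simpa using huv) hadj
  · exact key a T (by simpa using hadj) huv_adj
  · exact key b S (by simpa using hadj) huv_adj.symm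
  · refine SimpleGraph.isMinorOf_of_clique_of_connected hclique hW w {Sum.inr S, Sum.inr T}
      (by simp) (SimpleGraph.induce_pair_connected_of_adj huv_adj) (S.1 ∪ T.1) ?_ fun c hc => ?_
    · have hST : ¬ T.1 ⊆ S.1 := fun h => huv <| congrArg _ <| Subtype.ext
        (Finset.eq_of_subset_of_card_le h (by rw [S.2.1, T.2.1])).symm
      have hlt : S.1.card < (S.1 ∪ T.1).card := Finset.card_lt_card
        ⟨Finset.subset_union_left, fun h => hST (Finset.subset_union_right.trans h)⟩
      rw [S.2.1] at hlt
      omega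
    · rcases Finset.mem_union.1 hc with hc | hc
      · exact ⟨_, Or.inl rfl, hle (by simpa using hc)⟩
      · exact ⟨_, Or.inr rfl, hle (by simpa using hc)⟩

theorem card_subtype_card_eq_and_ne (hS₀ : S₀.card = k) :
    Fintype.card {S : Finset (Fin m) // S.card = k ∧ S ≠ S₀} = m.choose k - 1 := by
  rw [Fintype.card_subtype]
  have : (Finset.univ.filter fun S : Finset (Fin m) => S.card = k ∧ S ≠ S₀) =
      (Finset.powersetCard k Finset.univ).erase S₀ := by
    ext S
    simp [and_comm]
  rw [this, Finset.card_erase_of_mem (by simp [hS₀]), Finset.card_powersetCard,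
    Finset.card_fin]

theorem constructionGraph_edgeSet_eq :
    (constructionGraph m k S₀).edgeSet =
      Sym2.map Sum.inl '' (⊤ : SimpleGraph (Fin m)).edgeSet ∪
      Set.range fun p : (Σ S : {S : Finset (Fin m) // S.card = k ∧ S ≠ S₀}, S.1) =>
        s(Sum.inl p.2.1, Sum.inr p.1) := by
  ext e
  induction e with | _ u v
  rw [SimpleGraph.mem_edgeSet]
  constructor
  · intro h
    rcases u with a | S <;> rcases v with b | T
    · exact Or.inl ⟨s(a, b), by simpa using h, rfl⟩
    · exact Or.inr ⟨⟨T, a, by simpa using h⟩, rfl⟩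
    · exact Or.inr ⟨⟨S, b, by simpa using h⟩, Sym2.eq_swap⟩
    · simp at h
  · rw [← SimpleGraph.mem_edgeSet]
    rintro (⟨e, he, h⟩ | ⟨⟨S, a⟩, h⟩)
    · rw [← h]
      induction e with | _ a b
      simpa using he
    · rw [← h]
      simp

theorem ncard_edgeSet_constructionGraph :
    (constructionGraph m k S₀).edgeSet.ncard = m.choose 2 +
      k * Fintype.card {S : Finset (Fin m) // S.card = k ∧ S ≠ S₀} := by
  classical
  rw [constructionGraph_edgeSet_eq, Set.ncard_union_eq _ (Set.toFinite _) (Set.toFinite _)]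
  · congr 1
    · rw [Set.ncard_image_of_injective _ (Sym2.map.injective Sum.inl_injective),
        ← SimpleGraph.coe_edgeFinset, Set.ncard_coe_finset,
        SimpleGraph.card_edgeFinset_top_eq_card_choose_two, Fintype.card_fin]
    · rw [← Set.image_univ, Set.ncard_image_of_injective, Set.ncard_univ, Nat.card_eq_fintype_card,
        Fintype.card_sigma]
      · simp only [Fintype.card_coe]
        rw [Finset.sum_congr rfl fun S _ => S.2.1]
        simp [mul_comm]
      · rintro ⟨S, a, ha⟩ ⟨T, b, hb⟩ h
        simp only [Sym2.eq_iff, Sum.inl.injEq, Sum.inr.injEq, reduceCtorEq, false_and,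
          or_false] at h
        obtain ⟨rfl, rfl⟩ := h
        rfl
  · rw [Set.disjoint_left]
    rintro _ ⟨e, _, rfl⟩ ⟨p, hp⟩
    induction e with | _ a b
    simp at hp

end Construction

/-- The construction graph obtained from `K^{s-1}` by adding, for each
`(d-1)`-subset `S ≠ S₀`, a new vertex joined to `S`, is `M(H)`-saturated, and the counts
of its vertices and edges are `(s-1) + C(s-1,d-1) - 1` and
`C(s-1,2) + (d-1)·C(s-1,d-1) - (d-1)` respectively. -/
theorem constructionGraph_minorSaturated
    {W : Type*} [Fintype W] (H : SimpleGraph W) [DecidableRel H.Adj]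
    (hconn : H.Connected) (s d : ℕ) (hs : Fintype.card W = s)
    (hd : H.minDegree = d) (hd3 : 3 ≤ d)
    (S₀ : Finset (Fin (s - 1))) (hS₀ : S₀.card = d - 1) :
    MinorSaturated H (constructionGraph (s - 1) (d - 1) S₀) ∧
    Fintype.card (Fin (s - 1) ⊕ {S : Finset (Fin (s - 1)) // S.card = d - 1 ∧ S ≠ S₀})
      = (s - 1) + Nat.choose (s - 1) (d - 1) - 1 ∧
    (constructionGraph (s - 1) (d - 1) S₀).edgeSet.ncard
      = Nat.choose (s - 1) 2 + (d - 1) * Nat.choose (s - 1) (d - 1) - (d - 1) := by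
  have hW : Nonempty W := hconn.nonempty
  obtain ⟨w, hw⟩ := H.exists_minimal_degree_vertex
  have hs0 : 0 < s := hs ▸ Fintype.card_pos
  have hchoose : 0 < (s - 1).choose (d - 1) :=
    Nat.choose_pos (hS₀ ▸ (Finset.card_le_univ S₀).trans_eq (Fintype.card_fin _))
  refine ⟨⟨?_, fun u v huv hadj => ?_⟩, ?_, ?_⟩
  · refine not_isMinorOf_constructionGraph H (by omega) fun x => ?_
    have := H.minDegree_le_degree x
    omega
  · exact isMinorOf_constructionGraph_addEdge H (by omega) w (by omega) huv hadj
  · rw [Fintype.card_sum, Fintype.card_fin, card_subtype_card_eq_and_ne hS₀]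
    omega
  · rw [ncard_edgeSet_constructionGraph, card_subtype_card_eq_and_ne hS₀, Nat.mul_sub_one,
      Nat.add_sub_assoc (Nat.le_mul_of_pos_right _ hchoose)]
end
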